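/- Let F = ℚ(√5), ω = (1−√5)/2, B = ℍ[F, −3, √5], and let O be the O_F-submodule of B generated by BG₁ = 1, BG₂ = 1 + (ω/2)·j + (1/2)·k, BG₃ = (1−ω)/2 + (ω/2)·i, BG₄ = 1 + ω·j (the maximal order of B). Then there exists an element G₀ ∈ O with reduced trace 0 and reduced norm 7, i.e., G₀ + conj(G₀) = 0 and G₀ · conj(G₀) = 7; consequently G₀² = −7 in B, so that x ↦ G₀ defines an embedding of the CM field ℚ(√5, √−7) into B sending √−7 into O. -/

import Mathlib

set_option synthInstance.maxHeartbeats 1000000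
set_option maxHeartbeats 1000000

/-!
Statement 4: the maximal order O ⊂ B = ℍ[ℚ(√5), −3, √5] contains an element G₀
of reduced trace 0 and reduced norm 7; hence G₀² = −7 and the CM field
ℚ(√5, √−7) embeds into B with √−7 ↦ G₀ ∈ O.
-/

open IntermediateField NumberField Quaternion

noncomputable section

/-- `F = ℚ(√5)` as a subfield of `ℝ`. -/
abbrev F5 : IntermediateField ℚ ℝ := ℚ⟮Real.sqrt 5⟯

/-- `√5` as an element of `F = ℚ(√5)`. -/
def sqrt5 : F5 := ⟨Real.sqrt 5, IntermediateField.mem_adjoin_simple_self ℚ _⟩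

/-- `ω = (1 − √5)/2 ∈ F`. -/
def ω5 : F5 := (1 - sqrt5) / 2

/-- The quaternion algebra `B = ℍ[F, −3, √5]`. -/
abbrev Bq : Type _ := ℍ[F5, -3, sqrt5]

def BG₁ : Bq := ⟨1, 0, 0, 0⟩
def BG₂ : Bq := ⟨1, 0, ω5 / 2, 1 / 2⟩
def BG₃ : Bq := ⟨(1 - ω5) / 2, ω5 / 2, 0, 0⟩
def BG₄ : Bq := ⟨1, 0, ω5, 0⟩

/-- The maximal order `O` of `B`. -/
def Oord : Submodule (𝓞 F5) Bq := Submodule.span (𝓞 F5) {BG₁, BG₂, BG₃, BG₄}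

/-- The CM field `M = ℚ(√5, √−7)` as a subfield of `ℂ`. -/
abbrev M7 : IntermediateField ℚ ℂ :=
  IntermediateField.adjoin ℚ {(Real.sqrt 5 : ℂ), Complex.I * Real.sqrt 7}

/-- `√−7 = i·√7` as an element of `M = ℚ(√5, √−7)`. -/
def sqrtNeg7 : M7 :=
  ⟨Complex.I * Real.sqrt 7,
    IntermediateField.subset_adjoin ℚ _ (Set.mem_insert_of_mem _ rfl)⟩

/-- A ring homomorphism out of `K` transports along an embedding `g : K →+* L` to any subfield of
the image of `g`. -/
theorem exists_ringHom_of_le_fieldRange {K L A : Type*} [Field K] [Field L] [Ring A]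
    (g : K →+* L) (h : K →+* A) {S : Subfield L} (hS : S ≤ g.fieldRange) :
    ∃ f : S →+* A, ∀ (x : S) (k : K), g k = x → f x = h k := by
  let e : K ≃+* g.range := RingEquiv.ofBijective g.rangeRestrict
    ⟨fun x y hxy => g.injective (congrArg Subtype.val hxy), g.rangeRestrict_surjective⟩
  refine ⟨(h.comp e.symm.toRingHom).comp (Subring.inclusion (S := S.toSubring) (T := g.range) hS),
    fun x k hk => ?_⟩
  have hx : Subring.inclusion (S := S.toSubring) (T := g.range) hS x = e k :=
    Subtype.ext hk.symm
  simp [hx]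

theorem sqrt5_sq : sqrt5 ^ 2 = 5 := Subtype.ext <|
  (Real.sq_sqrt (by norm_num)).trans (map_ofNat (algebraMap F5 ℝ) 5).symm

theorem ω5_sq : ω5 ^ 2 = ω5 + 1 := by
  have h := sqrt5_sq
  simp only [ω5]
  linear_combination h / 4

theorem isIntegral_ω5 : IsIntegral ℤ ω5 := by
  refine ⟨Polynomial.X ^ 2 - Polynomial.X - 1, by monicity!, ?_⟩
  simp [ω5_sq]

instance fact_sq_ne_neg_seven : Fact (∀ r : F5, r ^ 2 ≠ -7 + 0 * r) := by
  refine ⟨fun r hr => ?_⟩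
  have h : algebraMap F5 ℝ r ^ 2 = -7 := by
    simpa only [zero_mul, add_zero, map_pow, map_neg, map_ofNat] using
      congrArg (algebraMap F5 ℝ) hr
  nlinarith [sq_nonneg (algebraMap F5 ℝ r)]

theorem I_mul_sqrt_seven_mul_self :
    (Complex.I * Real.sqrt 7) * (Complex.I * Real.sqrt 7) = -7 := by
  have h : ((Real.sqrt 7 : ℝ) : ℂ) ^ 2 = 7 := by
    rw [← Complex.ofReal_pow, Real.sq_sqrt (by norm_num)]
    norm_num
  linear_combination (Real.sqrt 7 : ℂ) ^ 2 * Complex.I_sq - h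

/-- Every square root of `-7` in an `F5`-algebra is the image of `√-7` under a ring homomorphism
out of `M7`. -/
theorem exists_ringHom_sqrtNeg7 {A : Type*} [Ring A] [Algebra F5 A] (u : A) (hu : u ^ 2 = -7) :
    ∃ f : M7 →+* A, f sqrtNeg7 = u := by
  let g : QuadraticAlgebra F5 (-7) 0 →ₐ[F5] ℂ :=
    QuadraticAlgebra.lift ⟨Complex.I * Real.sqrt 7, by
      rw [I_mul_sqrt_seven_mul_self, zero_smul, add_zero, ← Algebra.algebraMap_eq_smul_one,
        map_neg, map_ofNat]⟩
  let h : QuadraticAlgebra F5 (-7) 0 →ₐ[F5] A :=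
    QuadraticAlgebra.lift ⟨u, by
      rw [← sq, hu, zero_smul, add_zero, ← Algebra.algebraMap_eq_smul_one, map_neg, map_ofNat]⟩
  have hg : g (⟨0, 1⟩ : QuadraticAlgebra F5 (-7) 0) = Complex.I * Real.sqrt 7 := by simp [g]
  have hh : h ⟨0, 1⟩ = u := by simp [h]
  have hM : M7.toSubfield ≤ g.toRingHom.fieldRange := by
    refine IntermediateField.adjoin_le_subfield ℚ _ ?_ ?_
    · rintro _ ⟨q, rfl⟩
      rw [eq_ratCast]
      exact SubfieldClass.ratCast_mem _ q
    · rintro _ (rfl | rfl)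
      · exact ⟨algebraMap F5 (QuadraticAlgebra F5 (-7) 0) sqrt5, g.commutes sqrt5⟩
      · exact ⟨⟨0, 1⟩, hg⟩
  obtain ⟨f, hf⟩ := exists_ringHom_of_le_fieldRange g.toRingHom h.toRingHom hM
  exact ⟨f, (hf sqrtNeg7 ⟨0, 1⟩ hg).trans hh⟩

/-- The element `(1 - ω) i + ω j` of `B`. -/
def pureSqrtNegSeven : Bq := ⟨0, 1 - ω5, ω5, 0⟩

theorem pureSqrtNegSeven_mem : pureSqrtNegSeven ∈ Oord := by
  let w : 𝓞 F5 := ⟨ω5, isIntegral_ω5⟩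
  have h : pureSqrtNegSeven = (2 - 2 * w) • BG₁ + (2 * w - 4) • BG₃ + BG₄ := by
    have hw : ∀ (r : 𝓞 F5) (x : F5), r • x = (r : F5) * x := fun _ _ => rfl
    have hw' : (w : F5) = ω5 := rfl
    have h2 := ω5_sq
    refine QuaternionAlgebra.ext ?_ ?_ ?_ ?_
    all_goals simp [pureSqrtNegSeven, BG₁, BG₃, BG₄, hw, hw', map_ofNat]
    · linear_combination h2
    · linear_combination -h2
  rw [h]
  refine add_mem (add_mem ?_ ?_) ?_
  · exact Submodule.smul_mem _ _ (Submodule.subset_span (by simp))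
  · exact Submodule.smul_mem _ _ (Submodule.subset_span (by simp))
  · exact Submodule.subset_span (by simp)

theorem star_pureSqrtNegSeven : star pureSqrtNegSeven = -pureSqrtNegSeven := by
  ext <;> simp [pureSqrtNegSeven]

theorem pureSqrtNegSeven_sq : pureSqrtNegSeven ^ 2 = -7 := by
  have h2 := ω5_sq
  have h5 : sqrt5 = 1 - 2 * ω5 := by simp only [ω5]; ring
  have hcoe : (-7 : Bq) = ⟨-7, 0, 0, 0⟩ := by
    rw [← QuaternionAlgebra.algebraMap_eq, map_neg, map_ofNat]
  rw [hcoe, sq, pureSqrtNegSeven, QuaternionAlgebra.mk_mul_mk]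
  refine QuaternionAlgebra.ext ?_ ?_ ?_ ?_ <;> simp
  · linear_combination ω5 * ω5 * h5 - (2 * ω5 + 4) * h2
  · ring

theorem exists_G0_trace_zero_norm_seven :
    ∃ G₀ ∈ Oord, G₀ + star G₀ = 0 ∧ G₀ * star G₀ = 7 ∧ G₀ ^ 2 = -7 ∧
      ∃ f : M7 →+* Bq, f sqrtNeg7 = G₀ := by
  refine ⟨pureSqrtNegSeven, pureSqrtNegSeven_mem, ?_, ?_, pureSqrtNegSeven_sq,
    exists_ringHom_sqrtNeg7 _ pureSqrtNegSeven_sq⟩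
  · rw [star_pureSqrtNegSeven, add_neg_cancel]
  · rw [star_pureSqrtNegSeven, mul_neg, ← sq, pureSqrtNegSeven_sq, neg_neg]

end
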